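/- Let f(z,w) = (p(z), q(z,w)) be a regular polynomial skew product of ℂ² of degree d ≥ 2. If f is a special skew product, then the one-variable polynomial p is special, and for every p-periodic point z₀ of exact period n = n(z₀), the return map Q_{z₀}ⁿ is a special one-variable polynomial of degree dⁿ. -/

import Mathlib

open Polynomial

noncomputable section

def ChebT (d : ℕ) : Polynomial ℂ := dickson 1 1 d

def AffConj (f g : Polynomial ℂ) : Prop :=
  ∃ u v : ℂ, u ≠ 0 ∧ f = (C u⁻¹ * (X - C v)).comp (g.comp (C u * X + C v))

def SpecialPoly (d : ℕ) (f : Polynomial ℂ) : Prop :=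
  AffConj f (X ^ d) ∨ AffConj f (ChebT d) ∨ AffConj f (-ChebT d)

def fiber (q : Polynomial (Polynomial ℂ)) (z : ℂ) : Polynomial ℂ :=
  q.map (evalRingHom z)

def IsRegularSkew (d : ℕ) (p : Polynomial ℂ) (q : Polynomial (Polynomial ℂ)) : Prop :=
  p.natDegree = d ∧ (∀ k, q.coeff k ≠ 0 → (q.coeff k).natDegree + k ≤ d) ∧ q.coeff d ≠ 0

def polyIter (p : Polynomial ℂ) : ℕ → Polynomial ℂ
  | 0 => X
  | n + 1 => (polyIter p n).comp p

def QIter (p : Polynomial ℂ) (q : Polynomial (Polynomial ℂ)) : ℕ → ℂ → Polynomial ℂ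
  | 0, _ => X
  | n + 1, z => (QIter p q n (p.eval z)).comp (fiber q z)

def skewMap (p : Polynomial ℂ) (q : Polynomial (Polynomial ℂ)) : ℂ × ℂ → ℂ × ℂ :=
  fun zw => (p.eval zw.1, (fiber q zw.1).eval zw.2)

def TriangConj (f g : ℂ × ℂ → ℂ × ℂ) : Prop :=
  ∃ α β γ δ ε : ℂ, α ≠ 0 ∧ γ ≠ 0 ∧
    ∀ zw : ℂ × ℂ,
      (α * (g zw).1 + β, ε * (g zw).1 + γ * (g zw).2 + δ)
        = f (α * zw.1 + β, ε * zw.1 + γ * zw.2 + δ)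

def SpecialSkew (d : ℕ) (f : ℂ × ℂ → ℂ × ℂ) : Prop :=
  (∃ P Q : Polynomial ℂ,
      (P = X ^ d ∨ P = ChebT d ∨ P = -ChebT d) ∧
      (Q = X ^ d ∨ Q = ChebT d ∨ Q = -ChebT d) ∧
      TriangConj f fun zw => (P.eval zw.1, Q.eval zw.2))
  ∨ (∃ ζ : ℂ, ∃ m : ℕ, ζ ^ (d - 1) = 1 ∧ (m = 1 ∨ m = 2) ∧
      TriangConj f fun zw => (zw.1 ^ d, (dickson 1 (ζ * zw.1 ^ m) d).eval zw.2))

theorem affConj_iff {f g : ℂ[X]} :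
    AffConj f g ↔ ∃ u v : ℂ, u ≠ 0 ∧ ∀ x, u * f.eval x + v = g.eval (u * x + v) := by
  refine exists_congr fun u ↦ exists_congr fun v ↦ and_congr_right fun hu ↦ ?_
  constructor
  · rintro rfl x
    simp only [eval_comp, eval_mul, eval_sub, eval_add, eval_C, eval_X]
    field_simp
    ring
  · intro h
    refine Polynomial.funext fun x ↦ ?_
    simp only [eval_comp, eval_mul, eval_sub, eval_add, eval_C, eval_X, ← h x]
    field_simp
    ring

theorem AffConj.trans {f g h : ℂ[X]} (hfg : AffConj f g) (hgh : AffConj g h) : AffConj f h := by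
  rw [affConj_iff] at *
  obtain ⟨u, v, hu, H⟩ := hfg
  obtain ⟨a, b, ha, K⟩ := hgh
  refine ⟨a * u, a * v + b, mul_ne_zero ha hu, fun x ↦ ?_⟩
  have := K (u * x + v)
  rw [← H] at this
  rw [mul_assoc, ← add_assoc, ← mul_add, this]
  ring_nf

theorem AffConj.refl (f : ℂ[X]) : AffConj f f :=
  affConj_iff.2 ⟨1, 0, one_ne_zero, fun x ↦ by simp⟩

theorem AffConj.specialPoly {d : ℕ} {f g : ℂ[X]} (hfg : AffConj f g) (hg : SpecialPoly d g) :
    SpecialPoly d f :=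
  hg.imp hfg.trans (Or.imp hfg.trans hfg.trans)

theorem specialPoly_of_eq {d : ℕ} {P : ℂ[X]} (h : P = X ^ d ∨ P = ChebT d ∨ P = -ChebT d) :
    SpecialPoly d P := by
  rcases h with rfl | rfl | rfl
  exacts [.inl (.refl _), .inr (.inl (.refl _)), .inr (.inr (.refl _))]

theorem dickson_one_eval_add (x y : ℂ) (n : ℕ) :
    (dickson 1 (x * y) n).eval (x + y) = x ^ n + y ^ n := by
  induction n using Nat.twoStepInduction with
  | zero => norm_num [dickson_zero]
  | one => simp
  | more n h₀ h₁ =>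
    simp only [dickson_add_two, eval_sub, eval_mul, eval_X, eval_C, h₀, h₁]
    ring

theorem Complex.exists_add_eq_mul_eq (w a : ℂ) : ∃ x y : ℂ, x + y = w ∧ x * y = a := by
  obtain ⟨r, hr⟩ := IsAlgClosed.exists_pow_nat_eq (w ^ 2 - 4 * a) two_pos
  exact ⟨(w + r) / 2, (w - r) / 2, by ring, by linear_combination -hr / 4⟩

theorem dickson_one_mul_eval (a w : ℂ) (m n : ℕ) :
    (dickson 1 a (m * n)).eval w = (dickson 1 (a ^ n) m).eval ((dickson 1 a n).eval w) := by
  obtain ⟨x, y, rfl, rfl⟩ := Complex.exists_add_eq_mul_eq w a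
  rw [dickson_one_eval_add, dickson_one_eval_add, mul_pow, dickson_one_eval_add]
  ring

theorem dickson_one_eval_mul (b a w : ℂ) (n : ℕ) :
    (dickson 1 (b ^ 2 * a) n).eval (b * w) = b ^ n * (dickson 1 a n).eval w := by
  obtain ⟨x, y, rfl, rfl⟩ := Complex.exists_add_eq_mul_eq w a
  rw [dickson_one_eval_add, show b ^ 2 * (x * y) = b * x * (b * y) by ring, mul_add,
    dickson_one_eval_add]
  ring

theorem dickson_one_zero_eval (w : ℂ) {n : ℕ} (hn : n ≠ 0) :
    (dickson 1 0 n).eval w = w ^ n := by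
  simpa [hn] using dickson_one_eval_add w 0 n

theorem ChebT_comp_ChebT (m n : ℕ) : (ChebT m).comp (ChebT n) = ChebT (m * n) :=
  (dickson_one_one_mul ℂ m n).symm

theorem ChebT_comp_neg (n : ℕ) (f : ℂ[X]) :
    (ChebT n).comp (-f) = (ChebT n).comp f ∨ (ChebT n).comp (-f) = -(ChebT n).comp f := by
  have h (x : ℂ) : (ChebT n).eval (-x) = (-1) ^ n * (ChebT n).eval x := by
    simpa [ChebT] using dickson_one_eval_mul (-1) 1 x n
  rcases neg_one_pow_eq_or ℂ n with h1 | h1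
  · left
    refine Polynomial.funext fun x ↦ ?_
    simp [eval_comp, h, h1]
  · right
    refine Polynomial.funext fun x ↦ ?_
    simp [eval_comp, h, h1]

theorem polyIter_X_pow (d n : ℕ) : polyIter (X ^ d) n = X ^ d ^ n := by
  induction n with
  | zero => simp [polyIter]
  | succ n ih => simp [polyIter, ih, ← pow_mul, pow_succ, mul_comm]

theorem polyIter_ChebT_or_neg {d : ℕ} {Q : ℂ[X]} (hQ : Q = ChebT d ∨ Q = -ChebT d) (n : ℕ) :
    polyIter Q n = ChebT (d ^ n) ∨ polyIter Q n = -ChebT (d ^ n) := by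
  induction n with
  | zero => simp [polyIter, ChebT]
  | succ n ih =>
    have key : (ChebT (d ^ n)).comp Q = ChebT (d ^ (n + 1)) ∨
        (ChebT (d ^ n)).comp Q = -ChebT (d ^ (n + 1)) := by
      rw [pow_succ, ← ChebT_comp_ChebT]
      rcases hQ with rfl | rfl
      · exact .inl rfl
      · exact ChebT_comp_neg _ _
    rcases ih with ih | ih
    · simpa only [polyIter, ih] using key
    · simp only [polyIter, ih, neg_comp, neg_eq_iff_eq_neg, neg_neg]
      exact key.symm

theorem polyIter_mem_special {d : ℕ} {Q : ℂ[X]}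
    (hQ : Q = X ^ d ∨ Q = ChebT d ∨ Q = -ChebT d) (n : ℕ) :
    polyIter Q n = X ^ d ^ n ∨ polyIter Q n = ChebT (d ^ n) ∨
      polyIter Q n = -ChebT (d ^ n) := by
  rcases hQ with rfl | hQ
  · exact .inl (polyIter_X_pow d n)
  · exact .inr (polyIter_ChebT_or_neg hQ n)

theorem specialPoly_dickson {N : ℕ} (hN : N ≠ 0) {a : ℂ} (ha : a ^ N = a) :
    SpecialPoly N (dickson 1 a N) := by
  obtain ⟨b, rfl⟩ := IsAlgClosed.exists_pow_nat_eq a two_pos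
  rcases eq_or_ne b 0 with rfl | hb
  · refine specialPoly_of_eq (.inl (Polynomial.funext fun w ↦ ?_))
    simp [dickson_one_zero_eval w hN]
  · have hsq : (b ^ N) ^ 2 = b ^ 2 := by rw [← ha]; ring
    have key (x : ℂ) : (dickson 1 (b ^ 2) N).eval x = b ^ N * (ChebT N).eval (b⁻¹ * x) := by
      have := dickson_one_eval_mul b 1 (b⁻¹ * x) N
      rwa [mul_one, mul_inv_cancel_left₀ hb] at this
    rcases sq_eq_sq_iff_eq_or_eq_neg.1 hsq with h | h
    · refine .inr (.inl (affConj_iff.2 ⟨b⁻¹, 0, inv_ne_zero hb, fun x ↦ ?_⟩))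
      rw [key, h, add_zero, add_zero, inv_mul_cancel_left₀ hb]
    · refine .inr (.inr (affConj_iff.2 ⟨b⁻¹, 0, inv_ne_zero hb, fun x ↦ ?_⟩))
      rw [key, h, add_zero, add_zero, neg_mul, mul_neg, inv_mul_cancel_left₀ hb, eval_neg]

/-- If `skewMap p q` is triangularly conjugate to `(P, R)`, then `p` is affinely conjugate to `P`,
and the return maps of `skewMap p q` are affinely conjugate to the return maps `G` of `(P, R)`. -/
theorem affConj_of_triangConj {p : ℂ[X]} {q : ℂ[X][X]} {P : ℂ[X]} {R : ℂ → ℂ → ℂ}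
    (h : TriangConj (skewMap p q) fun zw ↦ (P.eval zw.1, R zw.1 zw.2))
    (G : ℕ → ℂ → ℂ[X]) (hG₀ : ∀ s, G 0 s = X)
    (hG : ∀ n s w, (G (n + 1) s).eval w = (G n (P.eval s)).eval (R s w)) :
    AffConj p P ∧ ∀ z n, (polyIter p n).eval z = z →
      ∃ s, (polyIter P n).eval s = s ∧ AffConj (QIter p q n z) (G n s) := by
  obtain ⟨α, β, γ, δ, ε, hα, hγ, h⟩ := h
  simp only [skewMap, Prod.mk.injEq, Prod.forall] at h
  have hp (s : ℂ) : p.eval (α * s + β) = α * P.eval s + β := (h s 0).1.symm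
  have hq (s w : ℂ) : (fiber q (α * s + β)).eval (ε * s + γ * w + δ) =
      ε * P.eval s + γ * R s w + δ := (h s w).2.symm
  have hpn (n : ℕ) (s : ℂ) :
      (polyIter p n).eval (α * s + β) = α * (polyIter P n).eval s + β := by
    induction n generalizing s with
    | zero => simp [polyIter]
    | succ n ih => simp only [polyIter, eval_comp, hp, ih]
  have hQn (n : ℕ) (s w : ℂ) : (QIter p q n (α * s + β)).eval (ε * s + γ * w + δ) =
      ε * (polyIter P n).eval s + γ * (G n s).eval w + δ := by
    induction n generalizing s w with
    | zero => simp [polyIter, QIter, hG₀]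
    | succ n ih => simp only [polyIter, QIter, eval_comp, hp, hq, ih, hG]
  refine ⟨affConj_iff.2 ⟨α⁻¹, -(α⁻¹ * β), inv_ne_zero hα, fun x ↦ ?_⟩, fun z n hz ↦ ?_⟩
  · have := hp (α⁻¹ * x + -(α⁻¹ * β))
    rw [show α * (α⁻¹ * x + -(α⁻¹ * β)) + β = x by field_simp; ring] at this
    rw [this]
    field_simp
    ring
  · obtain ⟨s, rfl⟩ : ∃ s, z = α * s + β := ⟨α⁻¹ * (z - β), by field_simp; ring⟩
    have hs : (polyIter P n).eval s = s := by
      rw [hpn] at hz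
      exact mul_left_cancel₀ hα (add_right_cancel hz)
    refine ⟨s, hs, affConj_iff.2 ⟨γ⁻¹, -(γ⁻¹ * (ε * s + δ)), inv_ne_zero hγ, fun x ↦ ?_⟩⟩
    have := hQn n s (γ⁻¹ * x + -(γ⁻¹ * (ε * s + δ)))
    rw [show ε * s + γ * (γ⁻¹ * x + -(γ⁻¹ * (ε * s + δ))) + δ = x by field_simp; ring, hs] at this
    rw [this]
    field_simp
    ring

theorem stmt2 (d : ℕ) (hd : 2 ≤ d) (p : Polynomial ℂ) (q : Polynomial (Polynomial ℂ))
    (hreg : IsRegularSkew d p q) (hf : SpecialSkew d (skewMap p q)) :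
    SpecialPoly d p ∧
      ∀ (z₀ : ℂ) (n : ℕ), 0 < n → (polyIter p n).eval z₀ = z₀ →
        (∀ m : ℕ, 0 < m → m < n → (polyIter p m).eval z₀ ≠ z₀) →
        SpecialPoly (d ^ n) (QIter p q n z₀) := by
  rcases hf with ⟨P, Q, hP, hQ, h⟩ | ⟨ζ, m, hζ, -, h⟩
  · obtain ⟨h₁, h₂⟩ := affConj_of_triangConj (R := fun _ w ↦ Q.eval w) h (fun n _ ↦ polyIter Q n)
      (fun _ ↦ rfl) (fun n s w ↦ by simp [polyIter])
    refine ⟨h₁.specialPoly (specialPoly_of_eq hP), fun z n _ hz _ ↦ ?_⟩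
    obtain ⟨s, -, hs⟩ := h₂ z n hz
    exact hs.specialPoly (specialPoly_of_eq (polyIter_mem_special hQ n))
  · have hζd : ζ ^ d = ζ := by
      rw [← Nat.sub_add_cancel (one_le_two.trans hd), pow_succ, hζ, one_mul]
    have hζn (n : ℕ) : ζ ^ d ^ n = ζ := by
      induction n with
      | zero => simp
      | succ n ih => rw [pow_succ, pow_mul, ih, hζd]
    obtain ⟨h₁, h₂⟩ := affConj_of_triangConj (P := X ^ d)
      (R := fun s w ↦ (dickson 1 (ζ * s ^ m) d).eval w) (by simpa using h)
      (fun n s ↦ dickson 1 (ζ * s ^ m) (d ^ n)) (fun s ↦ by simp) (fun n s w ↦ by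
        rw [pow_succ, dickson_one_mul_eval, mul_pow, hζd, eval_pow, eval_X, pow_right_comm])
    refine ⟨h₁.specialPoly (specialPoly_of_eq (.inl rfl)), fun z n _ hz _ ↦ ?_⟩
    obtain ⟨s, hs, hs'⟩ := h₂ z n hz
    rw [polyIter_X_pow, eval_pow, eval_X] at hs
    refine hs'.specialPoly (specialPoly_dickson (pow_ne_zero n (by lia)) ?_)
    rw [mul_pow, hζn, pow_right_comm, hs]
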